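/- For all integers n ≥ 0 and j ≥ 0, the identity Q_{n,j} = Σ_{k=0}^{n} h_k · Q̃_{n−k,j} holds as formal power series in x_1, x_2, …. -/

import Mathlib

/-!
STATEMENT 6: For all n ≥ 0 and j ≥ 0, Q_{n,j} = Σ_{k=0}^{n} h_k · Q̃_{n−k,j}
as formal power series in x_1, x_2, … over ℚ.
-/

open scoped Classical

/-- The one-line value `σ(i)` of a permutation of `[n] = {1,…,n}` (1-based), extended
to all of `ℕ` by the identity outside `[n]`. -/
def pv {n : ℕ} (σ : Equiv.Perm (Fin n)) (i : ℕ) : ℕ :=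
  if h : 1 ≤ i ∧ i ≤ n then ((σ ⟨i - 1, by omega⟩ : Fin n) : ℕ) + 1 else i

/-- The excedance set `Exc(σ) = {i ∈ [n-1] : σ(i) > i}`. -/
def ExcSet {n : ℕ} (σ : Equiv.Perm (Fin n)) : Finset ℕ :=
  (Finset.Icc 1 (n - 1)).filter fun i => i < pv σ i

/-- The excedance number `exc(σ) = |Exc(σ)|`. -/
def exc {n : ℕ} (σ : Equiv.Perm (Fin n)) : ℕ := (ExcSet σ).card

/-- The excedance-descent set `Exd(σ) ⊆ [n-1]`: `i ∈ Exd(σ)` iff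
(σ(i) ≤ i and σ(i+1) > i+1), or (σ(i) > i and σ(i+1) > i+1 and σ(i) > σ(i+1)),
or (σ(i) ≤ i and σ(i+1) ≤ i+1 and σ(i) > σ(i+1)). -/
def ExdSet {n : ℕ} (σ : Equiv.Perm (Fin n)) : Finset ℕ :=
  (Finset.Icc 1 (n - 1)).filter fun i =>
    (pv σ i ≤ i ∧ i + 1 < pv σ (i + 1)) ∨
    (i < pv σ i ∧ i + 1 < pv σ (i + 1) ∧ pv σ (i + 1) < pv σ i) ∨
    (pv σ i ≤ i ∧ pv σ (i + 1) ≤ i + 1 ∧ pv σ (i + 1) < pv σ i)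

/-- The ring of formal power series in countably many variables x_1, x_2, … over ℚ. -/
abbrev R : Type := MvPowerSeries ℕ+ ℚ

/-- The fundamental quasisymmetric function `F_{S,n}(x_1,x_2,…)`: its coefficient on the
monomial with exponent vector `d` is the number of sequences of positive integers
`i_1 ≥ ⋯ ≥ i_n` with `i_j > i_{j+1}` for all `j ∈ S` whose associated monomial
`x_{i_1}⋯x_{i_n}` is `x^d` (the sequence is recorded as `f : Fin n → ℕ+`, with `f j` the
`(j+1)`-st entry `i_{j+1}`). -/
noncomputable def Fqs (n : ℕ) (S : Finset ℕ) : R := fun d =>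
  (Nat.card {f : Fin n → ℕ+ //
    (∀ j : Fin n, ∀ hj : j.val + 1 < n,
      f ⟨j.val + 1, hj⟩ ≤ f j ∧ (j.val + 1 ∈ S → f ⟨j.val + 1, hj⟩ < f j)) ∧
    ∀ i : ℕ+, d i = (Finset.univ.filter fun j => f j = i).card} : ℚ)

/-- `Q_{n,j} = Σ F_{Exd(σ),n}` over permutations `σ ∈ S_n` with `exc(σ) = j`. -/
noncomputable def Qsym (n j : ℕ) : R :=
  ∑ σ ∈ Finset.univ.filter (fun σ : Equiv.Perm (Fin n) => exc σ = j), Fqs n (ExdSet σ)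

/-- The complete homogeneous symmetric function `h_n`: every monomial of total degree
`n` has coefficient `1`. -/
noncomputable def hSym (n : ℕ) : R := fun d => if (d.sum fun _ e => e) = n then 1 else 0

/-- `Q̃_{n,j} = Σ F_{Exd(σ),n}` over derangements `σ ∈ S_n` (permutations with no fixed
point) with `exc(σ) = j`.  (For `n = 0` this gives `Q̃_{0,0} = 1`, and `Q̃_{n,j} = 0`
whenever there is no such derangement.) -/
noncomputable def Qtilde (n j : ℕ) : R :=
  ∑ σ ∈ Finset.univ.filter
      (fun σ : Equiv.Perm (Fin n) => (∀ i, σ i ≠ i) ∧ exc σ = j),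
    Fqs n (ExdSet σ)

/-- The key ordering the letters of a permutation so that excedance values come first. -/
noncomputable def excKey {α : Type*} [LinearOrder α] (σ : Equiv.Perm α) (x : α) : Bool ×ₗ α :=
  toLex (decide (σ x ≤ x), σ x)

theorem excKey_lt_iff {α : Type*} [LinearOrder α] (σ : Equiv.Perm α) (x y : α) :
    excKey σ x < excKey σ y ↔
      (x < σ x ∧ σ y ≤ y) ∨ ((σ x ≤ x ↔ σ y ≤ y) ∧ σ x < σ y) := by
  simp only [excKey, Prod.Lex.toLex_lt_toLex, Bool.lt_iff, decide_eq_false_iff_not,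
    decide_eq_true_eq, not_le, decide_eq_decide]

/-- The excedance keys increase strictly along every fibre of `f`. -/
def KeyIncreasing {α β : Type*} [LinearOrder α] (f : α → β) (σ : Equiv.Perm α) : Prop :=
  ∀ x y, x < y → f x = f y → excKey σ x < excKey σ y

/-- Positions: a letter together with an index, larger letters coming first. -/
abbrev Pos : Type := ℕ+ᵒᵈ ×ₗ ℕ

/-- The letter of a position. -/
def Pos.letter (x : Pos) : ℕ+ := OrderDual.ofDual (ofLex x).1

/-- The index of a position among those with the same letter. -/
def Pos.index (x : Pos) : ℕ := (ofLex x).2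

/-- The position with given letter and index. -/
def Pos.mk (v : ℕ+) (i : ℕ) : Pos := toLex (OrderDual.toDual v, i)

@[simp] theorem Pos.letter_mk (v : ℕ+) (i : ℕ) : (Pos.mk v i).letter = v := rfl

@[simp] theorem Pos.index_mk (v : ℕ+) (i : ℕ) : (Pos.mk v i).index = i := rfl

theorem Pos.mk_injective (v : ℕ+) : Function.Injective (Pos.mk v) := fun i j h => by
  simpa using congrArg Pos.index h

theorem Pos.lt_iff (x y : Pos) :
    x < y ↔ y.letter < x.letter ∨ (x.letter = y.letter ∧ x.index < y.index) := by
  rw [Prod.Lex.lt_iff]; rfl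

theorem Pos.letter_antitone : Antitone Pos.letter := fun x y h => by
  rcases h.eq_or_lt with rfl | h
  · rfl
  · rcases (Pos.lt_iff x y).1 h with h | h
    · exact h.le
    · exact h.1.ge

theorem Pos.eq_mk_succ {v : ℕ+} {i : ℕ} {z : Pos} (h₁ : Pos.mk v i < z)
    (h₂ : z ≤ Pos.mk v (i + 1)) : z = Pos.mk v (i + 1) := by
  refine h₂.eq_of_not_lt fun h₃ => ?_
  rw [Pos.lt_iff] at h₁ h₃
  simp only [Pos.letter_mk, Pos.index_mk] at h₁ h₃
  rcases h₁ with h₁ | h₁ <;> rcases h₃ with h₃ | h₃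
  · exact lt_asymm h₁ h₃
  · exact h₁.ne h₃.1
  · exact h₃.ne h₁.1
  · omega

/-- The positions occupied by a word of content `d`. -/
noncomputable def positions (d : ℕ+ →₀ ℕ) : Finset Pos :=
  (d.support.sigma fun v => Finset.range (d v)).map
    ⟨fun p => Pos.mk p.1 p.2, fun p q h => by
      have h₁ := congrArg Pos.letter h
      have h₂ := congrArg Pos.index h
      simp only [Pos.letter_mk, Pos.index_mk] at h₁ h₂
      exact Sigma.ext h₁ (heq_of_eq h₂)⟩

@[simp] theorem mem_positions {d : ℕ+ →₀ ℕ} {x : Pos} :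
    x ∈ positions d ↔ x.index < d x.letter := by
  simp only [positions, Finset.mem_map, Finset.mem_sigma, Finsupp.mem_support_iff,
    Finset.mem_range, Sigma.exists]
  constructor
  · rintro ⟨v, i, ⟨-, h⟩, rfl⟩
    exact h
  · intro h
    exact ⟨x.letter, x.index, ⟨by omega, h⟩, rfl⟩

theorem card_positions (d : ℕ+ →₀ ℕ) : (positions d).card = d.sum fun _ e => e := by
  simp [positions, Finsupp.sum]

theorem card_positions_filter (d : ℕ+ →₀ ℕ) (v : ℕ+) :
    ((positions d).filter fun x => x.letter = v).card = d v := by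
  have : ((positions d).filter fun x => x.letter = v) =
      (Finset.range (d v)).map ⟨Pos.mk v, Pos.mk_injective v⟩ := by
    ext x
    simp only [Finset.mem_filter, mem_positions, Finset.mem_map, Finset.mem_range,
      Function.Embedding.coeFn_mk]
    constructor
    · rintro ⟨h, rfl⟩
      exact ⟨x.index, h, rfl⟩
    · rintro ⟨i, h, rfl⟩
      exact ⟨h, rfl⟩
  rw [this, Finset.card_map, Finset.card_range]

/-- The permutations of `Pos` that fix everything outside `positions d`. -/
noncomputable def permsOn (d : ℕ+ →₀ ℕ) : Finset (Equiv.Perm Pos) :=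
  Finset.univ.image (Equiv.Perm.ofSubtype (p := (· ∈ positions d)))

theorem mem_permsOn {d : ℕ+ →₀ ℕ} {τ : Equiv.Perm Pos} :
    τ ∈ permsOn d ↔ ∀ x, x ∉ positions d → τ x = x := by
  simp only [permsOn, Finset.mem_image, Finset.mem_univ, true_and]
  constructor
  · rintro ⟨σ, rfl⟩ x hx
    exact Equiv.Perm.ofSubtype_apply_of_not_mem σ hx
  · intro h
    have := (Equiv.Perm.subtypeEquivSubtypePerm (· ∈ positions d)).apply_symm_apply ⟨τ, h⟩
    exact ⟨_, congrArg Subtype.val this⟩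

/-- The number of excedances of a permutation of positions. -/
noncomputable def posExc (τ : Equiv.Perm Pos) : ℕ := {x | x < τ x}.ncard

/-- Key-increasing permutations of the positions of `d` with `j` excedances. -/
noncomputable def keyPerms (d : ℕ+ →₀ ℕ) (j : ℕ) : Finset (Equiv.Perm Pos) :=
  (permsOn d).filter fun τ => KeyIncreasing Pos.letter τ ∧ posExc τ = j

/-- Key-increasing derangements of the positions of `d` with `j` excedances. -/
noncomputable def keyDerangements (d : ℕ+ →₀ ℕ) (j : ℕ) : Finset (Equiv.Perm Pos) :=
  (permsOn d).filter fun τ =>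
    (∀ x ∈ positions d, τ x ≠ x) ∧ KeyIncreasing Pos.letter τ ∧ posExc τ = j

theorem KeyIncreasing.fixed_succ {τ : Equiv.Perm Pos} (hτ : KeyIncreasing Pos.letter τ)
    {v : ℕ+} {i : ℕ} (h : τ (Pos.mk v i) = Pos.mk v i) :
    τ (Pos.mk v (i + 1)) = Pos.mk v (i + 1) := by
  have key := hτ (Pos.mk v i) (Pos.mk v (i + 1)) (by simp [Pos.lt_iff]) rfl
  rw [excKey_lt_iff, h] at key
  simp only [lt_irrefl, false_and, le_refl, true_iff, false_or] at key
  exact Pos.eq_mk_succ key.2 key.1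

theorem KeyIncreasing.fixed_of_le {τ : Equiv.Perm Pos} (hτ : KeyIncreasing Pos.letter τ)
    {v : ℕ+} {i k : ℕ} (hik : i ≤ k) (h : τ (Pos.mk v i) = Pos.mk v i) :
    τ (Pos.mk v k) = Pos.mk v k := by
  induction k, hik using Nat.le_induction with
  | base => exact h
  | succ k _ ih => exact hτ.fixed_succ ih

theorem keyPerms_eq_biUnion (d : ℕ+ →₀ ℕ) (j : ℕ) :
    keyPerms d j = (Finset.HasAntidiagonal.antidiagonal d).biUnion fun p => keyDerangements p.2 j := by
  ext τ
  simp only [keyPerms, keyDerangements, Finset.mem_filter, Finset.mem_biUnion, mem_permsOn,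
    Finset.HasAntidiagonal.mem_antidiagonal, Prod.exists]
  constructor
  · rintro ⟨hfix, hτ, hj⟩
    have hex (v : ℕ+) : ∃ i, τ (Pos.mk v i) = Pos.mk v i := ⟨d v, hfix _ (by simp)⟩
    have hle (v : ℕ+) : Nat.find (hex v) ≤ d v := Nat.find_min' _ (hfix _ (by simp))
    let b : ℕ+ →₀ ℕ := Finsupp.onFinset d.support (fun v => Nat.find (hex v)) fun v hv => by
      have := hle v
      rw [Finsupp.mem_support_iff]
      omega
    have hbd : b ≤ d := hle
    refine ⟨d - b, b, tsub_add_cancel_of_le hbd, fun x hx => ?_, fun x hx => ?_, hτ, hj⟩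
    · rw [mem_positions, not_lt] at hx
      exact hτ.fixed_of_le (v := x.letter) hx (Nat.find_spec (hex x.letter))
    · rw [mem_positions] at hx
      exact Nat.find_min (hex x.letter) hx
  · rintro ⟨a, b, rfl, hfix, -, hτ, hj⟩
    refine ⟨fun x hx => hfix x fun h => hx ?_, hτ, hj⟩
    rw [mem_positions] at h ⊢
    exact h.trans_le (by simp)

theorem card_keyPerms (d : ℕ+ →₀ ℕ) (j : ℕ) :
    (keyPerms d j).card = ∑ p ∈ Finset.HasAntidiagonal.antidiagonal d, (keyDerangements p.2 j).card := by
  rw [keyPerms_eq_biUnion, Finset.card_biUnion]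
  rintro ⟨a, b⟩ hp ⟨a', b'⟩ hq hne
  refine Finset.disjoint_left.2 ?_
  intro τ h h'
  simp only [keyDerangements, Finset.mem_filter, mem_permsOn] at h h'
  have hX (x : Pos) : x ∈ positions b ↔ x ∈ positions b' := by
    constructor <;> intro hx <;> by_contra hx'
    · exact h.2.1 x hx (h'.1 x hx')
    · exact h'.2.1 x hx (h.1 x hx')
  have hb : b = b' := by
    ext v
    have h₁ := hX (Pos.mk v (b v))
    have h₂ := hX (Pos.mk v (b' v))
    simp only [mem_positions, Pos.letter_mk, Pos.index_mk, lt_irrefl] at h₁ h₂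
    simp only [false_iff, not_lt, iff_false] at h₁ h₂
    omega
  subst hb
  rw [Finset.mem_coe, Finset.HasAntidiagonal.mem_antidiagonal] at hp hq
  exact hne (congrArg (·, b) (add_right_cancel (hp.trans hq.symm)))

theorem eq_of_antitone_of_card_fiber {n : ℕ} {f g : Fin n → ℕ+} (hf : Antitone f)
    (hg : Antitone g)
    (h : ∀ v, (Finset.univ.filter fun i => f i = v).card =
      (Finset.univ.filter fun i => g i = v).card) : f = g := by
  apply List.ofFn_injective
  refine List.Perm.eq_of_pairwise (le := (· ≥ ·)) (fun a b _ _ h₁ h₂ => le_antisymm h₂ h₁)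
    ?_ ?_ ?_
  · rw [List.pairwise_ofFn]
    exact fun i j hij => hf hij.le
  · rw [List.pairwise_ofFn]
    exact fun i j hij => hg hij.le
  · rw [List.perm_iff_count]
    intro v
    have key (u : Fin n → ℕ+) :
        (List.ofFn u).count v = (Finset.univ.filter fun i => u i = v).card := by
      rw [List.ofFn_eq_map, List.count, List.countP_map, List.countP_eq_length_filter]
      rfl
    rw [key, key, h]

theorem antitone_of_apply_succ_le {n : ℕ} {f : Fin n → ℕ+}
    (hf : ∀ i : Fin n, ∀ hi : i.val + 1 < n, f ⟨i.val + 1, hi⟩ ≤ f i) : Antitone f := by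
  cases n with
  | zero => exact Subsingleton.antitone f
  | succ n => exact Fin.antitone_iff_succ_le.2 fun i => hf i.castSucc (by simp)

/-- The weakly decreasing word of content `d`. -/
noncomputable def contentWord {n : ℕ} {d : ℕ+ →₀ ℕ} (h : (positions d).card = n) :
    Fin n → ℕ+ := fun i => ((positions d).orderIsoOfFin h i : Pos).letter

theorem contentWord_antitone {n : ℕ} {d : ℕ+ →₀ ℕ} (h : (positions d).card = n) :
    Antitone (contentWord h) := fun _ _ hij =>
  Pos.letter_antitone (((positions d).orderIsoOfFin h).monotone hij)

theorem card_fiber_contentWord {n : ℕ} {d : ℕ+ →₀ ℕ} (h : (positions d).card = n) (v : ℕ+) :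
    (Finset.univ.filter fun i => contentWord h i = v).card = d v := by
  rw [← card_positions_filter d v]
  refine Finset.card_bij (fun i _ => ((positions d).orderIsoOfFin h i : Pos)) ?_ ?_ ?_
  · intro i hi
    exact Finset.mem_filter.2 ⟨Subtype.property _, (Finset.mem_filter.1 hi).2⟩
  · intro i _ k _ hik
    exact ((positions d).orderIsoOfFin h).injective (Subtype.ext hik)
  · intro x hx
    rw [Finset.mem_filter] at hx
    refine ⟨((positions d).orderIsoOfFin h).symm ⟨x, hx.1⟩, ?_, by simp⟩
    rw [Finset.mem_filter, contentWord, OrderIso.apply_symm_apply]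
    exact ⟨Finset.mem_univ _, hx.2⟩

theorem coeff_Fqs_of_card_ne {n : ℕ} {d : ℕ+ →₀ ℕ} (h : (positions d).card ≠ n)
    (S : Finset ℕ) : MvPowerSeries.coeff d (Fqs n S) = 0 := by
  change Fqs n S d = 0
  rw [Fqs, Nat.cast_eq_zero, Nat.card_eq_zero]
  refine Or.inl ⟨fun ⟨f, _, hf⟩ => h ?_⟩
  rw [card_positions, Finsupp.sum, Finset.sum_congr rfl fun v _ => hf v]
  rw [← Finset.card_eq_sum_card_fiberwise (s := Finset.univ) (f := f) (t := d.support),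
    Finset.card_univ, Fintype.card_fin]
  intro i _
  rw [Finset.mem_coe, Finsupp.mem_support_iff, hf]
  exact Finset.card_ne_zero_of_mem (a := i) (by simp)

theorem coeff_Fqs_of_card_eq {n : ℕ} {d : ℕ+ →₀ ℕ} (h : (positions d).card = n)
    (S : Finset ℕ) :
    MvPowerSeries.coeff d (Fqs n S) = if ∀ i : Fin n, ∀ hi : i.val + 1 < n,
      i.val + 1 ∈ S → contentWord h ⟨i.val + 1, hi⟩ < contentWord h i then 1 else 0 := by
  have huniq (f : Fin n → ℕ+)
      (hf : (∀ j : Fin n, ∀ hj : j.val + 1 < n,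
        f ⟨j.val + 1, hj⟩ ≤ f j ∧ (j.val + 1 ∈ S → f ⟨j.val + 1, hj⟩ < f j)) ∧
        ∀ i : ℕ+, d i = (Finset.univ.filter fun j => f j = i).card) : f = contentWord h :=
    eq_of_antitone_of_card_fiber (antitone_of_apply_succ_le fun i hi => (hf.1 i hi).1) (contentWord_antitone h)
      fun v => by rw [← hf.2, card_fiber_contentWord]
  change Fqs n S d = _
  rw [Fqs]
  split_ifs with hS
  · rw [Nat.cast_eq_one, Nat.card_eq_one_iff_unique]
    refine ⟨⟨fun f g => Subtype.ext ((huniq _ f.2).trans (huniq _ g.2).symm)⟩,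
      ⟨contentWord h, fun i hi => ⟨contentWord_antitone h ?_, hS i hi⟩,
        fun v => (card_fiber_contentWord h v).symm⟩⟩
    exact Fin.le_def.2 (Nat.le_succ _)
  · rw [Nat.cast_eq_zero, Nat.card_eq_zero]
    refine Or.inl ⟨fun f => hS fun i hi hiS => ?_⟩
    rw [← huniq _ f.2]
    exact (f.2.1 i hi).2 hiS

theorem pv_succ {n : ℕ} (σ : Equiv.Perm (Fin n)) (i : Fin n) :
    pv σ (i.val + 1) = (σ i).val + 1 := by
  have : 1 ≤ i.val + 1 ∧ i.val + 1 ≤ n := by omega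
  simp [pv]

theorem exc_eq_card {n : ℕ} (σ : Equiv.Perm (Fin n)) :
    exc σ = (Finset.univ.filter fun i => i < σ i).card := by
  symm
  refine Finset.card_bij (fun i _ => i.val + 1) ?_ ?_ ?_
  · intro i hi
    simp only [Finset.mem_filter, Finset.mem_univ, true_and, Fin.lt_def] at hi
    simp only [ExcSet, Finset.mem_filter, Finset.mem_Icc, pv_succ]
    omega
  · intro i _ k _ h
    omega
  · intro i hi
    simp only [ExcSet, Finset.mem_filter, Finset.mem_Icc] at hi
    refine ⟨⟨i - 1, by omega⟩, ?_, by simp; omega⟩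
    have := pv_succ σ ⟨i - 1, by omega⟩
    simp only [Nat.sub_add_cancel hi.1.1] at this
    simp only [Finset.mem_filter, Finset.mem_univ, true_and, Fin.lt_def]
    omega

theorem succ_mem_ExdSet_iff {n : ℕ} (σ : Equiv.Perm (Fin n)) (i : Fin n)
    (hi : i.val + 1 < n) :
    i.val + 1 ∈ ExdSet σ ↔ ¬ excKey σ i < excKey σ ⟨i.val + 1, hi⟩ := by
  have h₁ := pv_succ σ i
  have h₂ := pv_succ σ ⟨i.val + 1, hi⟩
  have hne : (σ i).val ≠ (σ ⟨i.val + 1, hi⟩).val := fun h => by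
    have := congrArg Fin.val (σ.injective (Fin.ext h))
    simp at this
  dsimp only at h₂
  simp only [ExdSet, Finset.mem_filter, Finset.mem_Icc, excKey_lt_iff, h₁, h₂, Fin.lt_def,
    Fin.le_def]
  omega

theorem forall_ExdSet_iff_keyIncreasing {n : ℕ} (σ : Equiv.Perm (Fin n)) {f : Fin n → ℕ+}
    (hf : Antitone f) :
    (∀ i : Fin n, ∀ hi : i.val + 1 < n, i.val + 1 ∈ ExdSet σ → f ⟨i.val + 1, hi⟩ < f i) ↔
      KeyIncreasing f σ := by
  refine (forall₂_congr fun i hi => by rw [succ_mem_ExdSet_iff σ i hi]).trans (b :=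
    ∀ i : Fin n, ∀ hi : i.val + 1 < n,
      ¬ excKey σ i < excKey σ ⟨i.val + 1, hi⟩ → f ⟨i.val + 1, hi⟩ < f i) ?_
  constructor
  · intro h
    have key (i : Fin n) (k : ℕ) (hik : i.val + 1 ≤ k) :
        ∀ hk : k < n, f i = f ⟨k, hk⟩ → excKey σ i < excKey σ ⟨k, hk⟩ := by
      induction k, hik using Nat.le_induction with
      | base =>
        intro hk hfi
        by_contra hlt
        exact (h i hk hlt).ne hfi.symm
      | succ k hik ih =>
        intro hk hfi
        have h₁ : f ⟨k, by omega⟩ ≤ f i := hf (Fin.le_def.2 (by simp; omega))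
        have h₂ : f ⟨k + 1, hk⟩ ≤ f ⟨k, by omega⟩ := hf (Fin.le_def.2 (by simp))
        refine (ih (by omega) (le_antisymm (hfi ▸ h₂) h₁)).trans ?_
        by_contra hlt
        exact ((h ⟨k, by omega⟩ hk hlt).trans_le h₁).ne hfi.symm
    exact fun i k hik => key i k hik k.2
  · intro h i hi hlt
    have hlt' : i < ⟨i.val + 1, hi⟩ := Fin.lt_def.2 (Nat.lt_succ_self _)
    exact (hf hlt'.le).lt_of_ne fun he => hlt (h _ _ hlt' he.symm)

/-- Transport of a permutation of `Fin n` to the positions of `d`. -/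
noncomputable def toPosPerm {n : ℕ} {d : ℕ+ →₀ ℕ} (h : (positions d).card = n)
    (σ : Equiv.Perm (Fin n)) : Equiv.Perm Pos :=
  σ.extendDomain ((positions d).orderIsoOfFin h).toEquiv

section Transport

variable {n : ℕ} {d : ℕ+ →₀ ℕ} (h : (positions d).card = n)

theorem toPosPerm_apply (σ : Equiv.Perm (Fin n)) (i : Fin n) :
    toPosPerm h σ ((positions d).orderIsoOfFin h i) = (positions d).orderIsoOfFin h (σ i) :=
  Equiv.Perm.extendDomain_apply_image σ ((positions d).orderIsoOfFin h).toEquiv i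

theorem toPosPerm_apply_of_notMem (σ : Equiv.Perm (Fin n)) {x : Pos} (hx : x ∉ positions d) :
    toPosPerm h σ x = x :=
  Equiv.Perm.extendDomain_apply_not_subtype σ ((positions d).orderIsoOfFin h).toEquiv hx

theorem exists_eq_orderIsoOfFin {x : Pos} (hx : x ∈ positions d) :
    ∃ i, ((positions d).orderIsoOfFin h i : Pos) = x :=
  ⟨((positions d).orderIsoOfFin h).symm ⟨x, hx⟩, by simp⟩

theorem toPosPerm_injective : Function.Injective (toPosPerm h) := by
  intro σ τ hστ
  ext1 i
  have := DFunLike.congr_fun hστ ((positions d).orderIsoOfFin h i : Pos)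
  rw [toPosPerm_apply, toPosPerm_apply] at this
  exact ((positions d).orderIsoOfFin h).injective (Subtype.ext this)

theorem toPosPerm_mem_permsOn (σ : Equiv.Perm (Fin n)) : toPosPerm h σ ∈ permsOn d :=
  mem_permsOn.2 fun _ hx => toPosPerm_apply_of_notMem h σ hx

theorem exists_toPosPerm_eq {τ : Equiv.Perm Pos} (hτ : τ ∈ permsOn d) :
    ∃ σ, toPosPerm h σ = τ := by
  simp only [permsOn, Finset.mem_image, Finset.mem_univ, true_and] at hτ
  obtain ⟨ρ, rfl⟩ := hτ
  let e := ((positions d).orderIsoOfFin h).toEquiv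
  refine ⟨e.symm.permCongr ρ, Equiv.ext fun x => ?_⟩
  by_cases hx : x ∈ positions d
  · obtain ⟨i, rfl⟩ := exists_eq_orderIsoOfFin h hx
    rw [toPosPerm_apply, Equiv.Perm.ofSubtype_apply_coe]
    simp [e, Equiv.permCongr_apply]
  · rw [toPosPerm_apply_of_notMem h _ hx, Equiv.Perm.ofSubtype_apply_of_not_mem _ hx]

theorem posExc_toPosPerm (σ : Equiv.Perm (Fin n)) : posExc (toPosPerm h σ) = exc σ := by
  have : {x | x < toPosPerm h σ x} =
      (fun i => ((positions d).orderIsoOfFin h i : Pos)) '' {i | i < σ i} := by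
    ext x
    simp only [Set.mem_ofPred_eq, Set.mem_image]
    constructor
    · intro hx
      by_cases hxd : x ∈ positions d
      · obtain ⟨i, rfl⟩ := exists_eq_orderIsoOfFin h hxd
        refine ⟨i, ?_, rfl⟩
        rw [toPosPerm_apply] at hx
        exact ((positions d).orderIsoOfFin h).lt_iff_lt.1 hx
      · rw [toPosPerm_apply_of_notMem h σ hxd] at hx
        exact absurd hx (lt_irrefl _)
    · rintro ⟨i, hi, rfl⟩
      rw [toPosPerm_apply]
      exact ((positions d).orderIsoOfFin h).lt_iff_lt.2 hi
  have hinj : Function.Injective fun i => ((positions d).orderIsoOfFin h i : Pos) :=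
    Subtype.val_injective.comp ((positions d).orderIsoOfFin h).injective
  rw [posExc, this, Set.ncard_image_of_injective _ hinj, exc_eq_card, ← Set.ncard_coe_finset]
  simp

theorem excKey_toPosPerm_lt_iff (σ : Equiv.Perm (Fin n)) (i k : Fin n) :
    excKey (toPosPerm h σ) ((positions d).orderIsoOfFin h i) <
      excKey (toPosPerm h σ) ((positions d).orderIsoOfFin h k) ↔ excKey σ i < excKey σ k := by
  simp only [excKey_lt_iff, toPosPerm_apply, Subtype.coe_lt_coe, Subtype.coe_le_coe,
    OrderIso.lt_iff_lt, OrderIso.le_iff_le]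

theorem keyIncreasing_toPosPerm_iff (σ : Equiv.Perm (Fin n)) :
    KeyIncreasing Pos.letter (toPosPerm h σ) ↔ KeyIncreasing (contentWord h) σ := by
  constructor
  · intro hσ i k hik hw
    exact (excKey_toPosPerm_lt_iff h σ i k).1
      (hσ _ _ (((positions d).orderIsoOfFin h).lt_iff_lt.2 hik) hw)
  · intro hσ x y hxy hw
    by_cases hy : y ∈ positions d
    · have hx : x ∈ positions d := by
        rw [mem_positions] at hy ⊢
        rcases (Pos.lt_iff x y).1 hxy with hlt | hlt
        · exact absurd hw hlt.ne'
        · exact hw ▸ hlt.2.trans hy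
      obtain ⟨i, rfl⟩ := exists_eq_orderIsoOfFin h hx
      obtain ⟨k, rfl⟩ := exists_eq_orderIsoOfFin h hy
      exact (excKey_toPosPerm_lt_iff h σ i k).2
        (hσ i k (((positions d).orderIsoOfFin h).lt_iff_lt.1 hxy) hw)
    · rw [excKey_lt_iff, toPosPerm_apply_of_notMem h σ hy]
      rcases lt_or_ge x (toPosPerm h σ x) with hlt | hle
      · exact Or.inl ⟨hlt, le_rfl⟩
      · exact Or.inr ⟨by simp [hle], hle.trans_lt hxy⟩

theorem derangement_toPosPerm_iff (σ : Equiv.Perm (Fin n)) :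
    (∀ x ∈ positions d, toPosPerm h σ x ≠ x) ↔ ∀ i, σ i ≠ i := by
  constructor
  · intro hσ i hi
    apply hσ _ ((positions d).orderIsoOfFin h i).2
    rw [toPosPerm_apply, hi]
  · intro hσ x hx
    obtain ⟨i, rfl⟩ := exists_eq_orderIsoOfFin h hx
    rw [toPosPerm_apply]
    exact fun he => hσ i (((positions d).orderIsoOfFin h).injective (Subtype.ext he))

theorem coeff_sum_Fqs (p : Equiv.Perm (Fin n) → Prop) [DecidablePred p] :
    MvPowerSeries.coeff d (∑ σ ∈ Finset.univ.filter p, Fqs n (ExdSet σ)) =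
      ((Finset.univ.filter fun σ =>
        p σ ∧ KeyIncreasing Pos.letter (toPosPerm h σ)).card : ℚ) := by
  simp only [map_sum, coeff_Fqs_of_card_eq h, keyIncreasing_toPosPerm_iff,
    forall_ExdSet_iff_keyIncreasing _ (contentWord_antitone h)]
  rw [Finset.sum_boole, Finset.filter_filter]

end Transport

theorem coeff_Qsym (n j : ℕ) (d : ℕ+ →₀ ℕ) :
    MvPowerSeries.coeff d (Qsym n j) =
      if (positions d).card = n then ((keyPerms d j).card : ℚ) else 0 := by
  split_ifs with h
  · rw [Qsym, coeff_sum_Fqs h, Nat.cast_inj]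
    refine Finset.card_bij (fun σ _ => toPosPerm h σ) ?_
      (fun _ _ _ _ hστ => toPosPerm_injective h hστ) ?_
    · intro σ hσ
      simp only [Finset.mem_filter, Finset.mem_univ, true_and] at hσ
      simp only [keyPerms, Finset.mem_filter, posExc_toPosPerm]
      exact ⟨toPosPerm_mem_permsOn h σ, hσ.2, hσ.1⟩
    · intro τ hτ
      simp only [keyPerms, Finset.mem_filter] at hτ
      obtain ⟨σ, rfl⟩ := exists_toPosPerm_eq h hτ.1
      rw [posExc_toPosPerm] at hτ
      exact ⟨σ, by simpa using hτ.2.symm, rfl⟩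
  · rw [Qsym, map_sum]
    exact Finset.sum_eq_zero fun σ _ => coeff_Fqs_of_card_ne h _

theorem coeff_Qtilde (n j : ℕ) (d : ℕ+ →₀ ℕ) :
    MvPowerSeries.coeff d (Qtilde n j) =
      if (positions d).card = n then ((keyDerangements d j).card : ℚ) else 0 := by
  split_ifs with h
  · rw [Qtilde, coeff_sum_Fqs h, Nat.cast_inj]
    refine Finset.card_bij (fun σ _ => toPosPerm h σ) ?_
      (fun _ _ _ _ hστ => toPosPerm_injective h hστ) ?_
    · intro σ hσ
      simp only [Finset.mem_filter, Finset.mem_univ, true_and] at hσ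
      simp only [keyDerangements, Finset.mem_filter, posExc_toPosPerm, derangement_toPosPerm_iff]
      exact ⟨toPosPerm_mem_permsOn h σ, hσ.1.1, hσ.2, hσ.1.2⟩
    · intro τ hτ
      simp only [keyDerangements, Finset.mem_filter] at hτ
      obtain ⟨σ, rfl⟩ := exists_toPosPerm_eq h hτ.1
      rw [posExc_toPosPerm, derangement_toPosPerm_iff] at hτ
      refine ⟨σ, ?_, rfl⟩
      simp only [Finset.mem_filter, Finset.mem_univ, true_and]
      exact ⟨⟨hτ.2.1, hτ.2.2.2⟩, hτ.2.2.1⟩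
  · rw [Qtilde, map_sum]
    exact Finset.sum_eq_zero fun σ _ => coeff_Fqs_of_card_ne h _

theorem coeff_hSym (k : ℕ) (d : ℕ+ →₀ ℕ) :
    MvPowerSeries.coeff d (hSym k) = if (positions d).card = k then 1 else 0 := by
  rw [card_positions]
  rfl

theorem coeff_hSym_mul_Qtilde (k m j : ℕ) (d : ℕ+ →₀ ℕ) :
    MvPowerSeries.coeff d (hSym k * Qtilde m j) =
      ∑ p ∈ Finset.HasAntidiagonal.antidiagonal d,
        if (positions p.1).card = k ∧ (positions p.2).card = m then
          ((keyDerangements p.2 j).card : ℚ) else 0 := by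
  rw [MvPowerSeries.coeff_mul]
  refine Finset.sum_congr rfl fun p _ => ?_
  rw [coeff_hSym, coeff_Qtilde, ite_and]
  split_ifs <;> simp

theorem card_positions_add (a b : ℕ+ →₀ ℕ) :
    (positions (a + b)).card = (positions a).card + (positions b).card := by
  simp only [card_positions]
  exact Finsupp.sum_add_index' (fun _ => rfl) fun _ _ _ => rfl

theorem Q_eq_sum_h_mul_Qtilde (n j : ℕ) :
    Qsym n j = ∑ k ∈ Finset.range (n + 1), hSym k * Qtilde (n - k) j := by
  ext d
  simp only [map_sum, coeff_hSym_mul_Qtilde]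
  rw [Finset.sum_comm, coeff_Qsym, card_keyPerms, Nat.cast_sum]
  trans ∑ p ∈ Finset.HasAntidiagonal.antidiagonal d,
    if (positions d).card = n then ((keyDerangements p.2 j).card : ℚ) else 0
  · split_ifs <;> simp
  refine Finset.sum_congr rfl fun p hp => ?_
  have hp' := card_positions_add p.1 p.2
  rw [Finset.HasAntidiagonal.mem_antidiagonal.1 hp] at hp'
  split_ifs with h
  · rw [Finset.sum_eq_single_of_mem (positions p.1).card
      (Finset.mem_range.2 (by omega)) fun k _ hk => if_neg fun hc => hk hc.1.symm]
    exact (if_pos ⟨rfl, by omega⟩).symm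
  · refine (Finset.sum_eq_zero fun k hk => if_neg fun hc => h ?_).symm
    rw [Finset.mem_range] at hk
    omega
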